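/- Let A ∈ BH_n(F) and π ∈ F^×. The linear map Θ(x^γ ⊗ e^I) = x^{γ+I} ⊗ e^I (where I ⊆ {1,…,n} is identified with its indicator vector in ℤ_{≥0}^n and e^I = e_{i_1}∧…∧e_{i_k}) is an injective chain map from the de Rham complex DR_A(F) to B^0_A(F), and it is a quasi-isomorphism: it induces isomorphisms on all cohomology groups. -/

import Mathlib

open scoped BigOperators TensorProduct
open Matrix Classical

noncomputable section

/-- The invertible-type polynomial `W_A = ∑ i, ∏ j, x_j ^ A i j`. -/
def Wpoly (F : Type) [Field F] {ι : Type} [Fintype ι] (A : Matrix ι ι ℕ) :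
    MvPolynomial ι F :=
  ∑ i, ∏ j, MvPolynomial.X j ^ A i j

/-- `A` is a Berglund–Hübsch matrix over the field `F`. -/
def IsBH (F : Type) [Field F] {ι : Type} [Fintype ι] [LinearOrder ι]
    (A : Matrix ι ι ℕ) : Prop :=
  (A.map ((↑) : ℕ → ℚ)).det ≠ 0 ∧
  (ringChar F = 0 ∨ ((A.map ((↑) : ℕ → ℤ)).det < (ringChar F : ℤ))) ∧
  (∃ q : ι → ℚ, (∀ j, 0 < q j) ∧ ∀ i, (∑ j, (A i j : ℚ) * q j) = 1) ∧
  RingTheory.Sequence.IsRegular (MvPolynomial ι F)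
    ((Finset.univ.sort (· ≤ ·)).map fun i => MvPolynomial.pderiv i (Wpoly F A))

/-- The model for the exterior algebra `⋀(Fⁿ)`: the free `F`-module on the standard
basis monomials `e_S = e_{s_1} ∧ … ∧ e_{s_k}`, `s_1 < … < s_k`, indexed by finite sets. -/
abbrev ExtV (F : Type) (ι : Type) := Finset ι → F

/-- Exterior multiplication by `e_i` on `⋀(Fⁿ)`. -/
def mulE (F : Type) [Field F] {ι : Type} [LinearOrder ι] (i : ι) :
    ExtV F ι →ₗ[F] ExtV F ι where
  toFun f S := if i ∈ S then (-1 : F) ^ (S.filter (· < i)).card * f (S.erase i) else 0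
  map_add' f g := by
    funext S
    by_cases h : i ∈ S <;> simp [h, mul_add]
  map_smul' a f := by
    funext S
    by_cases h : i ∈ S <;> simp [h, mul_left_comm]

/-- Contraction `e_i^∨` on `⋀(Fⁿ)`. -/
def contrE (F : Type) [Field F] {ι : Type} [LinearOrder ι] (i : ι) :
    ExtV F ι →ₗ[F] ExtV F ι where
  toFun f S := if i ∈ S then 0 else (-1 : F) ^ (S.filter (· < i)).card * f (insert i S)
  map_add' f g := by
    funext S
    by_cases h : i ∈ S <;> simp [h, mul_add]
  map_smul' a f := by
    funext S
    by_cases h : i ∈ S <;> simp [h, mul_left_comm]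

/-- `E_{A,i} = π ∑_j A_{ij} e_j`. -/
def EA (F : Type) [Field F] {ι : Type} [Fintype ι] [LinearOrder ι]
    (π : F) (A : Matrix ι ι ℕ) (i : ι) : ExtV F ι →ₗ[F] ExtV F ι :=
  π • ∑ j, (A i j : F) • mulE F j

/-- `E^∨_{A,i} = π⁻¹ ∑_j (A⁻¹)_{ji} e_j^∨`, the inverse matrix being computed over `F`. -/
def EAdual (F : Type) [Field F] {ι : Type} [Fintype ι] [LinearOrder ι]
    (π : F) (A : Matrix ι ι ℕ) (i : ι) : ExtV F ι →ₗ[F] ExtV F ι :=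
  π⁻¹ • ∑ j, ((A.map ((↑) : ℕ → F))⁻¹ j i) • contrE F j

/-- The element `E_{Aᵀ,1} E_{Aᵀ,2} ⋯ E_{Aᵀ,n} (1) ∈ ⋀(Fⁿ)`. -/
def starTop (F : Type) [Field F] {ι : Type} [Fintype ι] [LinearOrder ι]
    (π : F) (A : Matrix ι ι ℕ) : ExtV F ι :=
  (Finset.univ.sort (· ≤ ·)).foldr (fun i v => EA F π Aᵀ i v)
    (Pi.single (∅ : Finset ι) (1 : F))

/-- Borisov's duality operator `*^A`, defined on the standard basis by
`*^A(e_{i_1} ∧ … ∧ e_{i_k}) = E^∨_{Aᵀ,i_1} ⋯ E^∨_{Aᵀ,i_k}(E_{Aᵀ,1} ⋯ E_{Aᵀ,n}(1))`. -/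
def starA (F : Type) [Field F] {ι : Type} [Fintype ι] [LinearOrder ι]
    (π : F) (A : Matrix ι ι ℕ) : ExtV F ι →ₗ[F] ExtV F ι :=
  (Pi.basisFun F (Finset ι)).constr F fun S =>
    (S.sort (· ≤ ·)).foldr (fun i v => EAdual F π Aᵀ i v) (starTop F π A)

/-- Index of a monomial `x^γ y^λ`. -/
abbrev MonIdx (ι : Type) := (ι → ℕ) × (ι → ℕ)

/-- The matrix `A` viewed over `ℚ`. -/
def Aq {ι : Type} [Fintype ι] [LinearOrder ι] (A : Matrix ι ι ℕ) : Matrix ι ι ℚ :=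
  A.map ((↑) : ℕ → ℚ)

/-- The row vector `λ A⁻ᵀ`, computed over `ℚ`. -/
def lamRow {ι : Type} [Fintype ι] [LinearOrder ι] (A : Matrix ι ι ℕ) (lam : ι → ℕ) :
    ι → ℚ :=
  Matrix.vecMul (fun i => (lam i : ℚ)) ((Aq A)ᵀ)⁻¹

/-- The row vector `γ A⁻¹`, computed over `ℚ`. -/
def gamRow {ι : Type} [Fintype ι] [LinearOrder ι] (A : Matrix ι ι ℕ) (gam : ι → ℕ) :
    ι → ℚ :=
  Matrix.vecMul (fun i => (gam i : ℚ)) (Aq A)⁻¹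

/-- The allowed monomials `x^γ y^λ` of `R_A`: `(λA⁻ᵀ)_i ≥ 0` for all `i`, and
`γ A⁻¹ λᵀ = 0`. -/
def OKA {ι : Type} [Fintype ι] [LinearOrder ι] (A : Matrix ι ι ℕ) (m : MonIdx ι) : Prop :=
  (∀ i, 0 ≤ lamRow A m.2 i) ∧ (gamRow A m.1 ⬝ᵥ fun i => ((m.2 i : ℚ))) = 0

/-- The space `R_A(F)`: the free `F`-module on the allowed monomials `x^γ y^λ`. -/
abbrev RMod (F : Type) [Field F] {ι : Type} [Fintype ι] [LinearOrder ι]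
    (A : Matrix ι ι ℕ) := {m : MonIdx ι // OKA A m} →₀ F

/-- The monomial `x^γ y^λ` as an element of `R_A(F)` (`0` if not allowed). -/
def bE (F : Type) [Field F] {ι : Type} [Fintype ι] [LinearOrder ι]
    (A : Matrix ι ι ℕ) (m : MonIdx ι) : RMod F A :=
  if h : OKA A m then Finsupp.single ⟨m, h⟩ 1 else 0

/-- `θ_{A,i}(x^γ y^λ) = γ_i x^γ y^λ`. -/
def thetaOp (F : Type) [Field F] {ι : Type} [Fintype ι] [LinearOrder ι]
    (A : Matrix ι ι ℕ) (i : ι) : RMod F A →ₗ[F] RMod F A :=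
  Finsupp.linearCombination F fun m => ((m.1.1 i : F)) • Finsupp.single m (1 : F)

/-- `T^∨_{A,i}(x^γ y^λ) = π⁻¹ (λA⁻ᵀ)_i x^γ y^λ`, the matrix inverse being computed
over `F`. -/
def TdualOp (F : Type) [Field F] {ι : Type} [Fintype ι] [LinearOrder ι]
    (π : F) (A : Matrix ι ι ℕ) (i : ι) : RMod F A →ₗ[F] RMod F A :=
  Finsupp.linearCombination F fun m =>
    (π⁻¹ * Matrix.vecMul (fun k => ((m.1.2 k : F))) (((A.map ((↑) : ℕ → F))ᵀ)⁻¹) i) •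
      Finsupp.single m (1 : F)

/-- `ψ^∨_{A,i}(x^γ y^λ) = x^γ y^{λ + e_i Aᵀ}`. -/
def psidualOp (F : Type) [Field F] {ι : Type} [Fintype ι] [LinearOrder ι]
    (A : Matrix ι ι ℕ) (i : ι) : RMod F A →ₗ[F] RMod F A :=
  Finsupp.linearCombination F fun m => bE F A (m.1.1, fun j => m.1.2 j + A j i)

/-- `φ_{A,i}(x^γ y^λ) = π ∑_j A_{ji} x^{γ + e_j A} y^λ`. -/
def phiOp (F : Type) [Field F] {ι : Type} [Fintype ι] [LinearOrder ι]
    (π : F) (A : Matrix ι ι ℕ) (i : ι) : RMod F A →ₗ[F] RMod F A :=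
  Finsupp.linearCombination F fun m =>
    π • ∑ j, (A j i : F) • bE F A ((fun k => m.1.1 k + A j k), m.1.2)

/-- The underlying module of the complex `B_A(F) = R_A(F) ⊗ ⋀(Fⁿ)`. -/
abbrev BMod (F : Type) [Field F] {ι : Type} [Fintype ι] [LinearOrder ι]
    (A : Matrix ι ι ℕ) := TensorProduct F (RMod F A) (ExtV F ι)

/-- `d_{A,i} = (θ_{A,i} + φ_{A,i}) ⊗ e_i`. -/
def dSingle (F : Type) [Field F] {ι : Type} [Fintype ι] [LinearOrder ι]
    (π : F) (A : Matrix ι ι ℕ) (i : ι) : BMod F A →ₗ[F] BMod F A :=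
  TensorProduct.map (thetaOp F A i + phiOp F π A i) (mulE F i)

/-- `d^∨_{A,i} = (T^∨_{A,i} + ψ^∨_{A,i}) ⊗ e_i^∨`. -/
def dDualSingle (F : Type) [Field F] {ι : Type} [Fintype ι] [LinearOrder ι]
    (π : F) (A : Matrix ι ι ℕ) (i : ι) : BMod F A →ₗ[F] BMod F A :=
  TensorProduct.map (TdualOp F π A i + psidualOp F A i) (contrE F i)

/-- `d_A = ∑ i, d_{A,i}`. -/
def dOp (F : Type) [Field F] {ι : Type} [Fintype ι] [LinearOrder ι]
    (π : F) (A : Matrix ι ι ℕ) : BMod F A →ₗ[F] BMod F A :=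
  ∑ i, dSingle F π A i

/-- `d^∨_A = ∑ i, d^∨_{A,i}`. -/
def dDualOp (F : Type) [Field F] {ι : Type} [Fintype ι] [LinearOrder ι]
    (π : F) (A : Matrix ι ι ℕ) : BMod F A →ₗ[F] BMod F A :=
  ∑ i, dDualSingle F π A i

/-- The total differential `d_A + d^∨_A` of the complex `B_A(F)`. -/
def DOp (F : Type) [Field F] {ι : Type} [Fintype ι] [LinearOrder ι]
    (π : F) (A : Matrix ι ι ℕ) : BMod F A →ₗ[F] BMod F A :=
  dOp F π A + dDualOp F π A

end
noncomputable section

/-- The basis element `x^γ y^λ ⊗ e_S` of `B_A(F)`. -/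
def basisTensor (F : Type) [Field F] {ι : Type} [Fintype ι] [LinearOrder ι]
    (A : Matrix ι ι ℕ) (m : {m : MonIdx ι // OKA A m}) (S : Finset ι) : BMod F A :=
  Finsupp.single m (1 : F) ⊗ₜ[F] Pi.single S (1 : F)

/-- The subcomplex `B^λ_A(F) ⊆ B_A(F)` spanned by the monomials `x^γ y^{λ + μAᵀ} ⊗ e_S`. -/
def BlamSub (F : Type) [Field F] {ι : Type} [Fintype ι] [LinearOrder ι]
    (A : Matrix ι ι ℕ) (lam : ι → ℕ) : Submodule F (BMod F A) :=
  Submodule.span F {x | ∃ m S, (∃ μ : ι → ℕ, ∀ j, m.1.2 j = lam j + ∑ k, μ k * A j k) ∧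
    x = basisTensor F A m S}

/-- The subcomplex `B^0_A(F) ⊆ B_A(F)` spanned by the monomials `x^γ y^{μAᵀ} ⊗ e_S`. -/
def B0Sub (F : Type) [Field F] {ι : Type} [Fintype ι] [LinearOrder ι]
    (A : Matrix ι ι ℕ) : Submodule F (BMod F A) :=
  BlamSub F A 0

/-- The subcomplex `C_A(F) ⊆ B_A(F)` spanned by the monomials `x^γ y^λ ⊗ e_S` with
`(γA⁻¹)_i ≥ 0` for all `i`. -/
def CSub (F : Type) [Field F] {ι : Type} [Fintype ι] [LinearOrder ι]
    (A : Matrix ι ι ℕ) : Submodule F (BMod F A) :=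
  Submodule.span F {x | ∃ m S, (∀ i, 0 ≤ gamRow A m.1.1 i) ∧ x = basisTensor F A m S}

/-- The projection `P^∨_{A,i}` onto the span of monomials with `(λA⁻ᵀ)_i ≠ 0`. -/
def PdualOp (F : Type) [Field F] {ι : Type} [Fintype ι] [LinearOrder ι]
    (A : Matrix ι ι ℕ) (i : ι) : RMod F A →ₗ[F] RMod F A :=
  Finsupp.linearCombination F fun m =>
    if lamRow A m.1.2 i = 0 then 0 else Finsupp.single m (1 : F)

/-- `Q^∨_{A,i} = P^∨_{A,i} ⊗ e_i^∨ e_i`. -/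
def QdualOp (F : Type) [Field F] {ι : Type} [Fintype ι] [LinearOrder ι]
    (A : Matrix ι ι ℕ) (i : ι) : BMod F A →ₗ[F] BMod F A :=
  TensorProduct.map (PdualOp F A i) ((contrE F i).comp (mulE F i))

/-- `Q_{A,i} = Id ⊗ e_i e_i^∨ + Q^∨_{A,i}`. -/
def QOp (F : Type) [Field F] {ι : Type} [Fintype ι] [LinearOrder ι]
    (A : Matrix ι ι ℕ) (i : ι) : BMod F A →ₗ[F] BMod F A :=
  TensorProduct.map LinearMap.id ((mulE F i).comp (contrE F i)) + QdualOp F A i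

/-- The underlying module of the de Rham complex `DR_A(F)`: `F[x] ⊗ ⋀(Fⁿ)`. -/
abbrev DRMod (F : Type) [Field F] (ι : Type) := TensorProduct F (MvPolynomial ι F) (ExtV F ι)

/-- The twisted de Rham differential `∑ i, D_i ⊗ e_i`, `D_i = ∂_i + π (∂_i W_A)`. -/
def dDR (F : Type) [Field F] {ι : Type} [Fintype ι] [LinearOrder ι]
    (π : F) (A : Matrix ι ι ℕ) : DRMod F ι →ₗ[F] DRMod F ι :=
  ∑ i, TensorProduct.map
    ((MvPolynomial.pderiv i).toLinearMap +
      π • LinearMap.mulLeft F (MvPolynomial.pderiv i (Wpoly F A)))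
    (mulE F i)

/-- The projection of `⋀(Fⁿ)` onto the line spanned by the basis vector `e_S`. -/
def projS (F : Type) [Field F] {ι : Type} [Fintype ι] [LinearOrder ι] (S : Finset ι) :
    ExtV F ι →ₗ[F] ExtV F ι :=
  (Pi.basisFun F (Finset ι)).constr F fun T => if T = S then Pi.single S (1 : F) else 0

/-- The chain map `Θ : DR_A(F) → B^0_A(F)`, `x^γ ⊗ e_S ↦ x^{γ + S} y^0 ⊗ e_S`. -/
def ThetaMap (F : Type) [Field F] {ι : Type} [Fintype ι] [LinearOrder ι]
    (A : Matrix ι ι ℕ) : DRMod F ι →ₗ[F] BMod F A :=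
  ∑ S : Finset ι, TensorProduct.map
    ((MvPolynomial.basisMonomials ι F).constr F fun d =>
      bE F A ((fun j => d j + (if j ∈ S then 1 else 0)), 0))
    (projS F S)

/-- The "cohomology" `ker D ∩ P / D(P)` of the differential `D` restricted to the
subcomplex `P`. -/
def Hsub {F : Type} [Field F] {M : Type} [AddCommGroup M] [Module F M]
    (D : M →ₗ[F] M) (P : Submodule F M) :=
  ↥(LinearMap.ker D ⊓ P) ⧸
    Submodule.comap (LinearMap.ker D ⊓ P).subtype (Submodule.map D P)

end
noncomputable section

open DirectSum

/-- `TensorProduct.map`, specialized to the `B`-complexes. -/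
def mapB {F : Type} [Field F] {ι κ : Type} [Fintype ι] [LinearOrder ι]
    [Fintype κ] [LinearOrder κ] (A : Matrix ι ι ℕ) (B : Matrix κ κ ℕ)
    (T : RMod F A →ₗ[F] RMod F B) (L : ExtV F ι →ₗ[F] ExtV F κ) :
    BMod F A →ₗ[F] BMod F B :=
  TensorProduct.map T L

/-- `TensorProduct.map`, from a de Rham complex to a `B`-complex. -/
def mapDRB {F : Type} [Field F] {ι κ : Type} [Fintype ι] [LinearOrder ι]
    [Fintype κ] [LinearOrder κ] (B : Matrix κ κ ℕ)
    (T : MvPolynomial ι F →ₗ[F] RMod F B) (L : ExtV F ι →ₗ[F] ExtV F κ) :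
    DRMod F ι →ₗ[F] BMod F B :=
  TensorProduct.map T L

/-- The index set `S_λ = {i : (λA⁻ᵀ)_i = 0}`. -/
abbrev Slam {n : ℕ} (A : Matrix (Fin n) (Fin n) ℕ) (lam : Fin n → ℕ) : Type :=
  {i : Fin n // lamRow A lam i = 0}

/-- The principal submatrix `A^λ = (A_{ij})_{i,j ∈ S_λ}`. -/
def Alam {n : ℕ} (A : Matrix (Fin n) (Fin n) ℕ) (lam : Fin n → ℕ) :
    Matrix (Slam A lam) (Slam A lam) ℕ :=
  A.submatrix (fun k : Slam A lam => k.1) (fun k : Slam A lam => k.1)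

/-- Extension by zero of a vector indexed by `S_λ` to a vector indexed by `{1,…,n}`. -/
def extZero {n : ℕ} (A : Matrix (Fin n) (Fin n) ℕ) (lam : Fin n → ℕ)
    (g : Slam A lam → ℕ) : Fin n → ℕ :=
  fun j => if h : lamRow A lam j = 0 then g ⟨j, h⟩ else 0

/-- The inclusion of sets of exterior indices `S_λ ⊆ {1,…,n}`. -/
def extSet {n : ℕ} (A : Matrix (Fin n) (Fin n) ℕ) (lam : Fin n → ℕ)
    (S : Finset (Slam A lam)) : Finset (Fin n) :=
  S.map (Function.Embedding.subtype _)

/-- `R`-part of the map `B_{A^λ}(F) → B_A(F)`: `x^γ y^μ ↦ x^γ̃ y^{λ+μ̃}`. -/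
def PhiR (F : Type) [Field F] {n : ℕ} (A : Matrix (Fin n) (Fin n) ℕ)
    (lam : Fin n → ℕ) : RMod F (Alam A lam) →ₗ[F] RMod F A :=
  Finsupp.linearCombination F fun m =>
    bE F A (extZero A lam m.1.1, fun j => lam j + extZero A lam m.1.2 j)

/-- Exterior part of the map `B_{A^λ}(F) → B_A(F)`: `e_S ↦ e_S̃`. -/
def PhiE (F : Type) [Field F] {n : ℕ} (A : Matrix (Fin n) (Fin n) ℕ)
    (lam : Fin n → ℕ) : ExtV F (Slam A lam) →ₗ[F] ExtV F (Fin n) :=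
  (Pi.basisFun F (Finset (Slam A lam))).constr F fun S =>
    Pi.single (extSet A lam S) (1 : F)

/-- The map `B_{A^λ}(F) → B_A(F)`, `x^γ y^μ ⊗ e_S ↦ x^γ̃ y^{λ+μ̃} ⊗ e_S̃`. -/
def PhiLam (F : Type) [Field F] {n : ℕ} (A : Matrix (Fin n) (Fin n) ℕ)
    (lam : Fin n → ℕ) : BMod F (Alam A lam) →ₗ[F] BMod F A :=
  mapB (Alam A lam) A (PhiR F A lam) (PhiE F A lam)

/-- The canonical representatives of the classes of `G_A = ℤⁿ/ℤⁿAᵀ`: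
`0 ≤ (λA⁻ᵀ)_i < 1` for all `i`. -/
abbrev CanRep {n : ℕ} (A : Matrix (Fin n) (Fin n) ℕ) : Type :=
  {lam : Fin n → ℕ // ∀ i, 0 ≤ lamRow A lam i ∧ lamRow A lam i < 1}

/-- The unprojected orbifold de Rham complex `DR_{A^orb}(F) = ⊕_{λ ∈ G_A} DR_{A^λ}(F)`. -/
abbrev DROrb (F : Type) [Field F] {n : ℕ} (A : Matrix (Fin n) (Fin n) ℕ) : Type :=
  ⨁ (lam : CanRep A), DRMod F (Slam A lam.1)

/-- The differential of the orbifold de Rham complex, acting sector by sector. -/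
def dOrb (F : Type) [Field F] {n : ℕ} (π : F) (A : Matrix (Fin n) (Fin n) ℕ) :
    DROrb F A →ₗ[F] DROrb F A :=
  DirectSum.toModule F (CanRep A) (DROrb F A) fun lam =>
    (DirectSum.lof F (CanRep A) (fun l : CanRep A => DRMod F (Slam A l.1)) lam).comp
      (dDR F π (Alam A lam.1))

/-- The map `ι_λ : DR_{A^λ}(F) → B_A(F)`, `x^γ ⊗ e_S ↦ x^{γ̃+S̃} y^λ ⊗ e_S̃`. -/
def iotaLam (F : Type) [Field F] {n : ℕ} (A : Matrix (Fin n) (Fin n) ℕ)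
    (lam : Fin n → ℕ) : DRMod F (Slam A lam) →ₗ[F] BMod F A :=
  ∑ S : Finset (Slam A lam), mapDRB A
    ((MvPolynomial.basisMonomials (Slam A lam) F).constr F fun d =>
      bE F A (extZero A lam (fun k => d k + (if k ∈ S then 1 else 0)), lam))
    ((Pi.basisFun F (Finset (Slam A lam))).constr F fun T =>
      if T = S then Pi.single (extSet A lam S) (1 : F) else 0)

/-- The total map `∑_λ ι_λ : DR_{A^orb}(F) → B_A(F)`. -/
def iotaOrb (F : Type) [Field F] {n : ℕ} (A : Matrix (Fin n) (Fin n) ℕ) :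
    DROrb F A →ₗ[F] BMod F A :=
  DirectSum.toModule F (CanRep A) (BMod F A) fun lam => iotaLam F A lam.1

/-- The transposition map `D^A : x^γ y^λ ↦ x^λ y^γ` on monomial spaces. -/
def DAmap (F : Type) [Field F] {ι : Type} [Fintype ι] [LinearOrder ι]
    (A : Matrix ι ι ℕ) : RMod F A →ₗ[F] RMod F Aᵀ :=
  Finsupp.linearCombination F fun m => bE F Aᵀ (m.1.2, m.1.1)

/-- Berglund–Hübsch duality map `Δ^A = D^A ⊗ *^A`. -/
def DeltaMap (F : Type) [Field F] {ι : Type} [Fintype ι] [LinearOrder ι]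
    (π : F) (A : Matrix ι ι ℕ) : BMod F A →ₗ[F] BMod F Aᵀ :=
  mapB A Aᵀ (DAmap F A) (starA F π A)

end

noncomputable section

section Exterior

variable {F : Type} [Field F] {ι : Type} [LinearOrder ι]

/-- The index `j` obstructs `x^γ y^{μ Aᵀ} ⊗ e_S` from lying in the image of the de Rham complex. -/
def IsObstruction (γ μ : ι → ℕ) (S : Finset ι) (j : ι) : Prop :=
  (j ∉ S ∧ μ j ≠ 0) ∨ (j ∈ S ∧ γ j = 0)

/-- The least obstructing index of `x^γ y^{μ Aᵀ} ⊗ e_S` is `i`, and `i ∈ S`. -/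
def IsSource (γ μ : ι → ℕ) (S : Finset ι) (i : ι) : Prop :=
  (i ∈ S ∧ γ i = 0) ∧ ∀ j < i, ¬ IsObstruction γ μ S j

/-- The least obstructing index of `x^γ y^{μ Aᵀ} ⊗ e_S` is `i`, and `i ∉ S`. -/
def IsTarget (γ μ : ι → ℕ) (S : Finset ι) (i : ι) : Prop :=
  (i ∉ S ∧ μ i ≠ 0) ∧ ∀ j < i, ¬ IsObstruction γ μ S j

lemma IsSource.not_isTarget {γ μ : ι → ℕ} {S : Finset ι} {i j : ι} (h : IsSource γ μ S i) :
    ¬ IsTarget γ μ S j := by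
  intro h'
  rcases lt_trichotomy i j with hij | rfl | hij
  · exact h'.2 i hij (Or.inr h.1)
  · exact h'.1.1 h.1.1
  · exact h.2 j hij (Or.inl h'.1)

lemma IsTarget.unique {γ μ : ι → ℕ} {S : Finset ι} {i j : ι} (h : IsTarget γ μ S i)
    (h' : IsTarget γ μ S j) : i = j := by
  rcases lt_trichotomy i j with hij | rfl | hij
  · exact absurd (Or.inl h.1) (h'.2 i hij)
  · rfl
  · exact absurd (Or.inl h'.1) (h.2 j hij)

lemma isObstruction_erase_iff {γ μ : ι → ℕ} {S : Finset ι} {i j : ι} (hij : j ≠ i) :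
    IsObstruction γ (μ + Pi.single i 1) (S.erase i) j ↔ IsObstruction γ μ S j := by
  simp [IsObstruction, hij]

lemma IsSource.isTarget {γ μ : ι → ℕ} {S : Finset ι} {i : ι} (h : IsSource γ μ S i) :
    IsTarget γ (μ + Pi.single i 1) (S.erase i) i :=
  ⟨by simp, fun j hj => by
    rw [isObstruction_erase_iff hj.ne]
    exact h.2 j hj⟩

lemma IsTarget.exists_isSource {γ μ : ι → ℕ} {S : Finset ι} {i : ι} (h : IsTarget γ μ S i)
    (hγ : γ i = 0) :
    ∃ ν, μ = ν + Pi.single i 1 ∧ IsSource γ ν (insert i S) i := by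
  have hμ : μ = (μ - Pi.single i 1) + Pi.single i 1 := by
    funext j
    by_cases hj : j = i
    · subst hj
      have := h.1.2
      simp
      omega
    · simp [hj]
  refine ⟨_, hμ, ⟨by simp, hγ⟩, fun j hj => ?_⟩
  rw [← isObstruction_erase_iff hj.ne, ← hμ, Finset.erase_insert h.1.1]
  exact h.2 j hj

lemma IsSource.erase_of_ne {γ μ : ι → ℕ} {S : Finset ι} {i j : ι} (h : IsSource γ μ S i)
    (hij : j ≠ i) (hj : j ∈ S) (hγ : γ j = 0) :
    IsSource γ (μ + Pi.single j 1) (S.erase j) i := by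
  refine ⟨⟨Finset.mem_erase.2 ⟨hij.symm, h.1.1⟩, h.1.2⟩, fun l hl => ?_⟩
  by_cases hlj : l = j
  · subst hlj
    exact absurd (Or.inr ⟨hj, hγ⟩) (h.2 l hl)
  · rw [isObstruction_erase_iff hlj]
    exact h.2 l hl

/-- The sign of `e_i` relative to `e_S`. -/
def extSign (F : Type) [Field F] (i : ι) (S : Finset ι) : F :=
  (-1 : F) ^ (S.filter (· < i)).card

lemma extSign_mul_self (i : ι) (S : Finset ι) : extSign F i S * extSign F i S = 1 := by
  rw [extSign, ← mul_pow]
  simp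

lemma extSign_insert {i j : ι} {S : Finset ι} (hi : i ∉ S) :
    extSign F j (insert i S) = if i < j then -extSign F j S else extSign F j S := by
  unfold extSign
  rw [Finset.filter_insert]
  split_ifs
  · rw [Finset.card_insert_of_notMem (by simp [hi]), pow_succ]
    ring
  · rfl

lemma extSign_erase {i j : ι} {S : Finset ι} (hi : i ∈ S) :
    extSign F j (S.erase i) = if i < j then -extSign F j S else extSign F j S := by
  have := extSign_insert (F := F) (j := j) (Finset.notMem_erase i S)
  rw [Finset.insert_erase hi] at this
  rw [this]
  split_ifs <;> simp

lemma mulE_apply (i : ι) (f : ExtV F ι) (S : Finset ι) :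
    mulE F i f S = if i ∈ S then extSign F i S * f (S.erase i) else 0 := rfl

lemma contrE_apply (i : ι) (f : ExtV F ι) (S : Finset ι) :
    contrE F i f S = if i ∈ S then 0 else extSign F i S * f (insert i S) := rfl

lemma mulE_single (i : ι) (S : Finset ι) :
    mulE F i (Pi.single S 1) =
      if i ∈ S then 0 else extSign F i S • Pi.single (insert i S) (1 : F) := by
  funext T
  rw [mulE_apply]
  split_ifs with h1 h2 h2
  · rw [Pi.single_eq_of_ne, mul_zero, Pi.zero_apply]
    rintro rfl
    simp at h2
  · by_cases h : T.erase i = S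
    · subst h
      rw [Finset.insert_erase h1, extSign_erase h1]
      simp
    · rw [Pi.single_eq_of_ne h, Pi.smul_apply, Pi.single_eq_of_ne, mul_zero, smul_zero]
      rintro rfl
      exact h (Finset.erase_insert h2)
  · rfl
  · rw [Pi.smul_apply, Pi.single_eq_of_ne, smul_zero]
    rintro rfl
    simp at h1

lemma contrE_single (i : ι) (S : Finset ι) :
    contrE F i (Pi.single S 1) =
      if i ∈ S then extSign F i S • Pi.single (S.erase i) (1 : F) else 0 := by
  funext T
  rw [contrE_apply]
  split_ifs with h1 h2 h2
  · rw [Pi.smul_apply, Pi.single_eq_of_ne, smul_zero]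
    rintro rfl
    simp at h1
  · rfl
  · by_cases h : insert i T = S
    · subst h
      rw [Finset.erase_insert h1, extSign_insert h1]
      simp
    · rw [Pi.single_eq_of_ne h, Pi.smul_apply, Pi.single_eq_of_ne, mul_zero, smul_zero]
      rintro rfl
      exact h (Finset.insert_erase h2)
  · rw [Pi.single_eq_of_ne, mul_zero, Pi.zero_apply]
    rintro rfl
    simp at h2

lemma mulE_mulE_self (i : ι) (f : ExtV F ι) : mulE F i (mulE F i f) = 0 := by
  funext S
  simp [mulE_apply]

lemma contrE_contrE_self (i : ι) (f : ExtV F ι) : contrE F i (contrE F i f) = 0 := by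
  funext S
  simp [contrE_apply]

lemma mulE_mulE_anticomm {i j : ι} (hij : i ≠ j) (f : ExtV F ι) :
    mulE F i (mulE F j f) = -mulE F j (mulE F i f) := by
  funext S
  by_cases hi : i ∈ S <;> by_cases hj : j ∈ S <;>
    simp only [mulE_apply, Pi.neg_apply, hi, hj, Finset.mem_erase, hij, hij.symm, ne_eq,
      not_false_eq_true, and_true, and_false, if_true, if_false, mul_zero, neg_zero]
  rw [extSign_erase hi, extSign_erase hj, Finset.erase_right_comm]
  rcases lt_or_gt_of_ne hij with h | h <;> simp only [h, h.not_gt, if_true, if_false] <;> ring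

lemma contrE_contrE_anticomm {i j : ι} (hij : i ≠ j) (f : ExtV F ι) :
    contrE F i (contrE F j f) = -contrE F j (contrE F i f) := by
  funext S
  by_cases hi : i ∈ S <;> by_cases hj : j ∈ S <;>
    simp only [contrE_apply, Pi.neg_apply, hi, hj, Finset.mem_insert, hij, hij.symm,
      or_true, or_false, if_true, if_false, mul_zero, neg_zero]
  rw [extSign_insert hi, extSign_insert hj, Finset.insert_comm]
  rcases lt_or_gt_of_ne hij with h | h <;> simp only [h, h.not_gt, if_true, if_false] <;> ring

lemma mulE_contrE_add (i j : ι) (f : ExtV F ι) :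
    mulE F i (contrE F j f) + contrE F j (mulE F i f) = if i = j then f else 0 := by
  by_cases hij : i = j
  · subst hij
    funext S
    by_cases hi : i ∈ S
    · simp [mulE_apply, contrE_apply, hi, extSign_erase, ← mul_assoc, extSign_mul_self,
        Finset.insert_erase]
    · simp [mulE_apply, contrE_apply, hi, extSign_insert, ← mul_assoc, extSign_mul_self]
  · funext S
    rw [if_neg hij]
    by_cases hi : i ∈ S <;> by_cases hj : j ∈ S <;>
      simp only [mulE_apply, contrE_apply, Pi.add_apply, hi, hj, Finset.mem_insert,
        Finset.mem_erase, hij, Ne.symm hij, ne_eq, not_false_eq_true, and_true, and_false, or_true,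
        or_false, if_true, if_false, mul_zero, add_zero, Pi.zero_apply]
    rw [extSign_erase hi, extSign_insert hj, Finset.erase_insert_of_ne (Ne.symm hij)]
    rcases lt_or_gt_of_ne hij with h | h <;> simp only [h, h.not_gt, if_true, if_false] <;> ring

end Exterior

lemma Wpoly_eq_sum_monomial {F : Type} [Field F] {ι : Type} [Fintype ι]
    (A : Matrix ι ι ℕ) :
    Wpoly F A = ∑ j, MvPolynomial.monomial (Finsupp.equivFunOnFinite.symm (A j)) 1 := by
  refine Finset.sum_congr rfl fun j _ => ?_
  rw [MvPolynomial.monomial_eq, Finsupp.prod_fintype _ _ fun i => pow_zero _, map_one, one_mul]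
  rfl

section Complexes

variable {F : Type} [Field F] {ι : Type} [Fintype ι] [LinearOrder ι]

/-- The vector `μ Aᵀ`. -/
def mulTransposeVec (A : Matrix ι ι ℕ) (μ : ι → ℕ) : ι → ℕ := fun j => ∑ k, μ k * A j k

/-- The element `x^γ y^{μ Aᵀ}` of `R_A(F)`, equal to `0` if the monomial is not allowed. -/
def zeroMon (F : Type) [Field F] (A : Matrix ι ι ℕ) (γ μ : ι → ℕ) : RMod F A :=
  bE F A (γ, mulTransposeVec A μ)

lemma lamRow_mulTransposeVec {A : Matrix ι ι ℕ} (hA : (Aq A).det ≠ 0) (μ : ι → ℕ) :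
    lamRow A (mulTransposeVec A μ) = fun i => (μ i : ℚ) := by
  have h : (fun i => ((mulTransposeVec A μ i : ℕ) : ℚ)) =
      Matrix.vecMul (fun i => (μ i : ℚ)) (Aq A)ᵀ := by
    funext i
    simp [mulTransposeVec, Matrix.vecMul, dotProduct, Aq]
  have hu : IsUnit (Aq A)ᵀ.det := by
    rw [Matrix.det_transpose]
    exact hA.isUnit
  rw [lamRow, h, Matrix.vecMul_vecMul, Matrix.mul_nonsing_inv _ hu, Matrix.vecMul_one]

lemma OKA_mulTransposeVec_iff {A : Matrix ι ι ℕ} (hA : (Aq A).det ≠ 0) (γ μ : ι → ℕ) :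
    OKA A (γ, mulTransposeVec A μ) ↔ ∀ i, γ i = 0 ∨ μ i = 0 := by
  have h : (fun i => ((mulTransposeVec A μ i : ℕ) : ℚ)) =
      Matrix.mulVec (Aq A) (fun i => (μ i : ℚ)) := by
    funext i
    simp [mulTransposeVec, Matrix.mulVec, dotProduct, Aq, mul_comm]
  have h2 : (gamRow A γ ⬝ᵥ fun i => ((mulTransposeVec A μ i : ℕ) : ℚ)) =
      ((∑ i, γ i * μ i : ℕ) : ℚ) := by
    rw [h, gamRow, Matrix.dotProduct_mulVec, Matrix.vecMul_vecMul,
      Matrix.nonsing_inv_mul _ hA.isUnit, Matrix.vecMul_one]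
    simp [dotProduct]
  rw [OKA, lamRow_mulTransposeVec hA, h2]
  have h3 : ((∑ i, γ i * μ i : ℕ) : ℚ) = 0 ↔ ∀ i, γ i = 0 ∨ μ i = 0 := by
    rw [Nat.cast_eq_zero]
    simp
  simp [-Nat.cast_sum, h3]

lemma zeroMon_eq_zero {A : Matrix ι ι ℕ} (hA : (Aq A).det ≠ 0) {γ μ : ι → ℕ} (i : ι)
    (hγ : γ i ≠ 0) (hμ : μ i ≠ 0) : zeroMon F A γ μ = 0 := by
  rw [zeroMon, bE, dif_neg]
  rw [OKA_mulTransposeVec_iff hA]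
  intro h
  rcases h i with h | h <;> contradiction

lemma exists_of_not_OKA {A : Matrix ι ι ℕ} (hA : (Aq A).det ≠ 0) {γ μ : ι → ℕ}
    (h : ¬ OKA A (γ, mulTransposeVec A μ)) : ∃ i, γ i ≠ 0 ∧ μ i ≠ 0 := by
  rw [OKA_mulTransposeVec_iff hA] at h
  push Not at h
  exact h

lemma zeroMon_of_OKA {A : Matrix ι ι ℕ} {γ μ : ι → ℕ}
    (h : OKA A (γ, mulTransposeVec A μ)) : zeroMon F A γ μ = Finsupp.single ⟨_, h⟩ 1 := by
  rw [zeroMon, bE, dif_pos h]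

lemma thetaOp_zeroMon (A : Matrix ι ι ℕ) (i : ι) (γ μ : ι → ℕ) :
    thetaOp F A i (zeroMon F A γ μ) = (γ i : F) • zeroMon F A γ μ := by
  unfold zeroMon bE thetaOp
  split_ifs <;> simp

lemma phiOp_zeroMon {A : Matrix ι ι ℕ} (hA : (Aq A).det ≠ 0) (π : F) (i : ι) (γ μ : ι → ℕ) :
    phiOp F π A i (zeroMon F A γ μ) =
      π • ∑ j, (A j i : F) • zeroMon F A (fun k => γ k + A j k) μ := by
  by_cases h : OKA A (γ, mulTransposeVec A μ)
  · rw [zeroMon_of_OKA h, phiOp, Finsupp.linearCombination_single, one_smul]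
    rfl
  · obtain ⟨k, hk, hk'⟩ := exists_of_not_OKA hA h
    rw [zeroMon_eq_zero hA k hk hk', map_zero, Finset.sum_eq_zero, smul_zero]
    intro j _
    rw [zeroMon_eq_zero hA k (by omega) hk', smul_zero]

lemma psidualOp_zeroMon {A : Matrix ι ι ℕ} (hA : (Aq A).det ≠ 0) (i : ι) (γ μ : ι → ℕ) :
    psidualOp F A i (zeroMon F A γ μ) = zeroMon F A γ (μ + Pi.single i 1) := by
  by_cases h : OKA A (γ, mulTransposeVec A μ)
  · rw [zeroMon_of_OKA h, psidualOp, Finsupp.linearCombination_single, one_smul, zeroMon]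
    congr 2
    funext j
    simp [mulTransposeVec, add_mul, Finset.sum_add_distrib, Pi.single_apply]
  · obtain ⟨k, hk, hk'⟩ := exists_of_not_OKA hA h
    rw [zeroMon_eq_zero hA k hk hk', map_zero, zeroMon_eq_zero hA k hk]
    simp [hk']

/-- The element of `F` equal to `1` or `0` according to whether `A` is invertible over `F`. -/
def invIndicator (F : Type) [Field F] (A : Matrix ι ι ℕ) : F :=
  if IsUnit ((A.map ((↑) : ℕ → F))ᵀ).det then 1 else 0

lemma TdualOp_zeroMon (A : Matrix ι ι ℕ) (π : F) (i : ι) (γ μ : ι → ℕ) :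
    TdualOp F π A i (zeroMon F A γ μ) =
      (π⁻¹ * (invIndicator F A * (μ i : F))) • zeroMon F A γ μ := by
  have h : (fun i => ((mulTransposeVec A μ i : ℕ) : F)) =
      Matrix.vecMul (fun i => (μ i : F)) (A.map ((↑) : ℕ → F))ᵀ := by
    funext i
    simp [mulTransposeVec, Matrix.vecMul, dotProduct]
  by_cases hok : OKA A (γ, mulTransposeVec A μ)
  · rw [zeroMon_of_OKA hok, TdualOp, Finsupp.linearCombination_single, one_smul]
    simp only
    rw [h, Matrix.vecMul_vecMul, invIndicator]
    split_ifs with hu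
    · rw [Matrix.mul_nonsing_inv _ hu, Matrix.vecMul_one, one_mul]
    · rw [Matrix.nonsing_inv_apply_not_isUnit _ hu]
      simp
  · rw [zeroMon, bE, dif_neg hok]
    simp

/-- The element `x^γ y^{μ Aᵀ} ⊗ e_S` of `B_A(F)`, equal to `0` if the monomial is not allowed. -/
def zeroTensor (F : Type) [Field F] (A : Matrix ι ι ℕ) (γ μ : ι → ℕ) (S : Finset ι) :
    BMod F A :=
  zeroMon F A γ μ ⊗ₜ[F] Pi.single S (1 : F)

lemma zeroTensor_eq_zero {A : Matrix ι ι ℕ} (hA : (Aq A).det ≠ 0) {γ μ : ι → ℕ}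
    {S : Finset ι} (i : ι) (hγ : γ i ≠ 0) (hμ : μ i ≠ 0) : zeroTensor F A γ μ S = 0 := by
  rw [zeroTensor, zeroMon_eq_zero hA i hγ hμ, TensorProduct.zero_tmul]

lemma zeroTensor_of_OKA {A : Matrix ι ι ℕ} {γ μ : ι → ℕ} {S : Finset ι}
    (h : OKA A (γ, mulTransposeVec A μ)) :
    zeroTensor F A γ μ S = basisTensor F A ⟨_, h⟩ S := by
  rw [zeroTensor, zeroMon_of_OKA h, basisTensor]

lemma DOp_tmul (π : F) (A : Matrix ι ι ℕ) (m : RMod F A) (v : ExtV F ι) :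
    DOp F π A (m ⊗ₜ v) =
      ∑ i, ((thetaOp F A i m + phiOp F π A i m) ⊗ₜ[F] mulE F i v) +
        ∑ i, ((TdualOp F π A i m + psidualOp F A i m) ⊗ₜ[F] contrE F i v) := by
  simp [DOp, dOp, dDualOp, dSingle, dDualSingle, LinearMap.sum_apply]

lemma DOp_zeroTensor {A : Matrix ι ι ℕ} (hA : (Aq A).det ≠ 0) (π : F) (γ μ : ι → ℕ)
    (S : Finset ι) :
    DOp F π A (zeroTensor F A γ μ S) =
      (∑ i, if i ∈ S then 0 else extSign F i S • ((γ i : F) • zeroTensor F A γ μ (insert i S) +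
        π • ∑ j, (A j i : F) • zeroTensor F A (fun k => γ k + A j k) μ (insert i S))) +
      ∑ i, if i ∈ S then extSign F i S •
        ((π⁻¹ * (invIndicator F A * (μ i : F))) • zeroTensor F A γ μ (S.erase i) +
          zeroTensor F A γ (μ + Pi.single i 1) (S.erase i)) else 0 := by
  rw [zeroTensor, DOp_tmul]
  congr 1
  · refine Finset.sum_congr rfl fun i _ => ?_
    rw [thetaOp_zeroMon, phiOp_zeroMon hA, mulE_single]
    split_ifs
    · simp
    · simp only [zeroTensor, TensorProduct.tmul_smul, TensorProduct.add_tmul,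
        ← TensorProduct.smul_tmul', TensorProduct.sum_tmul]
  · refine Finset.sum_congr rfl fun i _ => ?_
    rw [TdualOp_zeroMon, psidualOp_zeroMon hA, contrE_single]
    split_ifs
    · simp only [zeroTensor, TensorProduct.tmul_smul, TensorProduct.add_tmul,
        ← TensorProduct.smul_tmul']
    · simp

lemma sum_sum_eq_zero_of_antisymm {M : Type} [AddCommGroup M] (f : ι → ι → M)
    (hd : ∀ i, f i i = 0) (h : ∀ i j, i ≠ j → f i j = -f j i) : ∑ i, ∑ j, f i j = 0 := by
  rw [← Finset.sum_product']
  refine Finset.sum_involution (fun p _ => (p.2, p.1)) ?_ ?_ ?_ ?_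
  · rintro ⟨i, j⟩ _
    by_cases hij : i = j
    · simp [hij, hd]
    · simp [h i j hij]
  · rintro ⟨i, j⟩ _ hne heq
    simp only [Prod.mk.injEq] at heq
    rw [heq.1] at hne
    exact hne (hd i)
  · simp
  · simp

lemma koszul_square_eq_zero {M E : Type} [AddCommGroup M] [Module F M] [AddCommGroup E]
    [Module F E] (P Q : ι → M →ₗ[F] M) (e c : ι → E →ₗ[F] E) (b : M) (v : E)
    (hee : ∀ i, e i (e i v) = 0) (hee' : ∀ i j, i ≠ j → e i (e j v) = -e j (e i v))
    (hcc : ∀ i, c i (c i v) = 0) (hcc' : ∀ i j, i ≠ j → c i (c j v) = -c j (c i v))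
    (hec : ∀ i j, e i (c j v) + c j (e i v) = if i = j then v else 0)
    (hPP : ∀ i j, P i (P j b) = P j (P i b)) (hQQ : ∀ i j, Q i (Q j b) = Q j (Q i b))
    (hPQ : ∀ i j, P i (Q j b) = Q j (P i b)) (hz : ∀ i, P i (Q i b) = 0) :
    ∑ j, (∑ i, P i (P j b) ⊗ₜ[F] e i (e j v) + ∑ i, Q i (P j b) ⊗ₜ[F] c i (e j v)) +
      ∑ j, (∑ i, P i (Q j b) ⊗ₜ[F] e i (c j v) + ∑ i, Q i (Q j b) ⊗ₜ[F] c i (c j v)) = 0 := by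
  have h1 : ∑ j, ∑ i, P i (P j b) ⊗ₜ[F] e i (e j v) = 0 := by
    refine sum_sum_eq_zero_of_antisymm (fun j i => P i (P j b) ⊗ₜ[F] e i (e j v))
      (fun i => ?_) fun i j hij => ?_
    · rw [hee, TensorProduct.tmul_zero]
    · rw [hee' j i hij.symm, hPP, TensorProduct.tmul_neg]
  have h2 : ∑ j, ∑ i, Q i (Q j b) ⊗ₜ[F] c i (c j v) = 0 := by
    refine sum_sum_eq_zero_of_antisymm (fun j i => Q i (Q j b) ⊗ₜ[F] c i (c j v))
      (fun i => ?_) fun i j hij => ?_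
    · rw [hcc, TensorProduct.tmul_zero]
    · rw [hcc' j i hij.symm, hQQ, TensorProduct.tmul_neg]
  have h3 : ∑ j, ∑ i, Q i (P j b) ⊗ₜ[F] c i (e j v) +
      ∑ j, ∑ i, P i (Q j b) ⊗ₜ[F] e i (c j v) = 0 := by
    rw [Finset.sum_comm, ← Finset.sum_add_distrib]
    refine Finset.sum_eq_zero fun i _ => ?_
    rw [← Finset.sum_add_distrib]
    refine Finset.sum_eq_zero fun j _ => ?_
    rw [← hPQ, ← TensorProduct.tmul_add, add_comm, hec]
    split_ifs with hij
    · rw [hij, hz, TensorProduct.zero_tmul]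
    · rw [TensorProduct.tmul_zero]
  rw [Finset.sum_add_distrib, Finset.sum_add_distrib, h1, h2, zero_add, add_zero, h3]

lemma thetaOp_phiOp_zeroMon {A : Matrix ι ι ℕ} (hA : (Aq A).det ≠ 0) (π : F) (i j : ι)
    (γ μ : ι → ℕ) :
    thetaOp F A i (phiOp F π A j (zeroMon F A γ μ)) =
      (γ i : F) • phiOp F π A j (zeroMon F A γ μ) +
        π • ∑ k, ((A k i : F) * (A k j : F)) • zeroMon F A (fun l => γ l + A k l) μ := by
  rw [phiOp_zeroMon hA, map_smul, map_sum, smul_comm (γ i : F) π, ← smul_add,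
    Finset.smul_sum (r := (γ i : F)), ← Finset.sum_add_distrib]
  congr 1
  refine Finset.sum_congr rfl fun k _ => ?_
  rw [map_smul, thetaOp_zeroMon, Nat.cast_add]
  module

lemma phiOp_phiOp_zeroMon {A : Matrix ι ι ℕ} (hA : (Aq A).det ≠ 0) (π : F) (i j : ι)
    (γ μ : ι → ℕ) :
    phiOp F π A i (phiOp F π A j (zeroMon F A γ μ)) =
      phiOp F π A j (phiOp F π A i (zeroMon F A γ μ)) := by
  simp only [phiOp_zeroMon hA, map_smul, map_sum, Finset.smul_sum]
  rw [Finset.sum_comm]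
  refine Finset.sum_congr rfl fun k _ => Finset.sum_congr rfl fun l _ => ?_
  simp only [add_right_comm _ (A k _) (A l _)]
  module

lemma horizontal_comm_zeroMon {A : Matrix ι ι ℕ} (hA : (Aq A).det ≠ 0) (π : F) (i j : ι)
    (γ μ : ι → ℕ) :
    (thetaOp F A i + phiOp F π A i) ((thetaOp F A j + phiOp F π A j) (zeroMon F A γ μ)) =
      (thetaOp F A j + phiOp F π A j) ((thetaOp F A i + phiOp F π A i) (zeroMon F A γ μ)) := by
  simp only [LinearMap.add_apply, map_add, thetaOp_phiOp_zeroMon hA, thetaOp_zeroMon, map_smul,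
    phiOp_phiOp_zeroMon hA π i j, mul_comm (A _ j : F)]
  module

lemma vertical_comm_zeroMon {A : Matrix ι ι ℕ} (hA : (Aq A).det ≠ 0) (π : F) (i j : ι)
    (γ μ : ι → ℕ) :
    (TdualOp F π A i + psidualOp F A i) ((TdualOp F π A j + psidualOp F A j) (zeroMon F A γ μ)) =
      (TdualOp F π A j + psidualOp F A j)
        ((TdualOp F π A i + psidualOp F A i) (zeroMon F A γ μ)) := by
  by_cases hij : i = j
  · rw [hij]
  simp only [LinearMap.add_apply, map_add, TdualOp_zeroMon, psidualOp_zeroMon hA, map_smul,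
    Pi.add_apply, Pi.single_eq_of_ne hij, Pi.single_eq_of_ne (Ne.symm hij), add_zero,
    add_right_comm _ (Pi.single i 1) (Pi.single j 1)]
  module

lemma horizontal_vertical_comm_zeroMon {A : Matrix ι ι ℕ} (hA : (Aq A).det ≠ 0) (π : F)
    (i j : ι) (γ μ : ι → ℕ) :
    (thetaOp F A i + phiOp F π A i) ((TdualOp F π A j + psidualOp F A j) (zeroMon F A γ μ)) =
      (TdualOp F π A j + psidualOp F A j)
        ((thetaOp F A i + phiOp F π A i) (zeroMon F A γ μ)) := by
  simp only [LinearMap.add_apply, map_add, TdualOp_zeroMon, psidualOp_zeroMon hA, map_smul,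
    map_sum, thetaOp_zeroMon, phiOp_zeroMon hA]
  simp only [smul_add, Finset.smul_sum, Finset.sum_add_distrib, smul_smul,
    mul_comm, mul_left_comm, mul_assoc]
  abel

lemma horizontal_vertical_zeroMon {A : Matrix ι ι ℕ} (hA : (Aq A).det ≠ 0) (π : F)
    (γ μ : ι → ℕ) (i : ι) :
    (thetaOp F A i + phiOp F π A i) ((TdualOp F π A i + psidualOp F A i) (zeroMon F A γ μ)) =
      0 := by
  have key (ν : ι → ℕ) (hν : ν i ≠ 0) :
      (thetaOp F A i + phiOp F π A i) (zeroMon F A γ ν) = 0 := by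
    rw [LinearMap.add_apply, thetaOp_zeroMon, phiOp_zeroMon hA, Finset.sum_eq_zero, smul_zero,
      add_zero]
    · by_cases h : γ i = 0
      · simp [h]
      · rw [zeroMon_eq_zero hA i h hν, smul_zero]
    · intro j _
      by_cases h : A j i = 0
      · simp [h]
      · rw [zeroMon_eq_zero hA i (by omega) hν, smul_zero]
  rw [LinearMap.add_apply (TdualOp F π A i), map_add, TdualOp_zeroMon, psidualOp_zeroMon hA,
    map_smul, key (μ + Pi.single i 1) (by simp), add_zero]
  by_cases h : μ i = 0
  · simp [h]
  · rw [key μ h, smul_zero]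

lemma DOp_DOp_zeroTensor {A : Matrix ι ι ℕ} (hA : (Aq A).det ≠ 0) (π : F) (γ μ : ι → ℕ)
    (S : Finset ι) : DOp F π A (DOp F π A (zeroTensor F A γ μ S)) = 0 := by
  rw [zeroTensor, DOp_tmul, map_add, map_sum, map_sum]
  simp only [DOp_tmul]
  exact koszul_square_eq_zero (fun i => thetaOp F A i + phiOp F π A i)
    (fun i => TdualOp F π A i + psidualOp F A i) (mulE F) (contrE F) _ _
    (fun i => mulE_mulE_self i _) (fun i j h => mulE_mulE_anticomm h _)
    (fun i => contrE_contrE_self i _) (fun i j h => contrE_contrE_anticomm h _)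
    (fun i j => mulE_contrE_add i j _) (fun i j => horizontal_comm_zeroMon hA π i j γ μ)
    (fun i j => vertical_comm_zeroMon hA π i j γ μ)
    (fun i j => horizontal_vertical_comm_zeroMon hA π i j γ μ)
    (horizontal_vertical_zeroMon hA π γ μ)

/-- The span of the elements `x^γ y^{μ Aᵀ} ⊗ e_S` with `∑ μ_i < m`. -/
def degSub (F : Type) [Field F] (A : Matrix ι ι ℕ) (m : ℕ) : Submodule F (BMod F A) :=
  Submodule.span F {x | ∃ γ μ S, ∑ i, μ i < m ∧ x = zeroTensor F A γ μ S}

/-- The span of the source elements `x^γ y^{μ Aᵀ} ⊗ e_S` with `∑ μ_i < m`. -/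
def sourceSub (F : Type) [Field F] (A : Matrix ι ι ℕ) (m : ℕ) : Submodule F (BMod F A) :=
  Submodule.span F {x | ∃ γ μ S i, IsSource γ μ S i ∧ ∑ i, μ i < m ∧ x = zeroTensor F A γ μ S}

lemma zeroTensor_mem_degSub (A : Matrix ι ι ℕ) {m : ℕ} (γ μ : ι → ℕ) (S : Finset ι)
    (h : ∑ i, μ i < m) : zeroTensor F A γ μ S ∈ degSub F A m :=
  Submodule.subset_span ⟨γ, μ, S, h, rfl⟩

lemma IsSource.zeroTensor_mem_sourceSub (A : Matrix ι ι ℕ) {m : ℕ} {γ μ : ι → ℕ}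
    {S : Finset ι} {i : ι} (hs : IsSource γ μ S i) (h : ∑ i, μ i < m) :
    zeroTensor F A γ μ S ∈ sourceSub F A m :=
  Submodule.subset_span ⟨γ, μ, S, i, hs, h, rfl⟩

lemma degSub_mono (A : Matrix ι ι ℕ) {m k : ℕ} (h : m ≤ k) : degSub F A m ≤ degSub F A k := by
  refine Submodule.span_le.2 ?_
  rintro _ ⟨γ, μ, S, hm, rfl⟩
  exact zeroTensor_mem_degSub A _ _ _ (hm.trans_le h)

lemma sourceSub_mono (A : Matrix ι ι ℕ) {m k : ℕ} (h : m ≤ k) :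
    sourceSub F A m ≤ sourceSub F A k := by
  refine Submodule.span_le.2 ?_
  rintro _ ⟨γ, μ, S, i, hs, hm, rfl⟩
  exact hs.zeroTensor_mem_sourceSub A (hm.trans_le h)

lemma sourceSub_le_degSub (A : Matrix ι ι ℕ) (m : ℕ) : sourceSub F A m ≤ degSub F A m := by
  refine Submodule.span_le.2 ?_
  rintro _ ⟨γ, μ, S, i, hs, hm, rfl⟩
  exact zeroTensor_mem_degSub A _ _ _ hm

lemma sum_add_single (μ : ι → ℕ) (i : ι) : ∑ j, (μ + Pi.single i 1 : ι → ℕ) j = ∑ j, μ j + 1 := by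
  simp [Finset.sum_add_distrib]

lemma IsSource.DOp_sub_mem {A : Matrix ι ι ℕ} (hA : (Aq A).det ≠ 0) (π : F) {γ μ : ι → ℕ}
    {S : Finset ι} {i : ι} (h : IsSource γ μ S i) :
    DOp F π A (zeroTensor F A γ μ S) -
        extSign F i S • zeroTensor F A γ (μ + Pi.single i 1) (S.erase i) ∈
      sourceSub F A (∑ j, μ j + 2) ⊔ degSub F A (∑ j, μ j + 1) := by
  have hmain : extSign F i S • zeroTensor F A γ (μ + Pi.single i 1) (S.erase i) =
      ∑ j, if j = i then
        extSign F j S • zeroTensor F A γ (μ + Pi.single j 1) (S.erase j) else 0 := by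
    simp
  rw [DOp_zeroTensor hA, hmain, add_sub_assoc (G := BMod F A),
    ← Finset.sum_sub_distrib (G := BMod F A)]
  have hdeg (γ' : ι → ℕ) (T : Finset ι) : zeroTensor F A γ' μ T ∈
      sourceSub F A (∑ j, μ j + 2) ⊔ degSub F A (∑ j, μ j + 1) :=
    Submodule.mem_sup_right (zeroTensor_mem_degSub A _ _ _ (Nat.lt_succ_self _))
  refine Submodule.add_mem _ (Submodule.sum_mem _ fun j _ => ?_)
    (Submodule.sum_mem _ fun j _ => ?_)
  · split_ifs
    · exact Submodule.zero_mem _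
    · exact Submodule.smul_mem _ _ (Submodule.add_mem _ (Submodule.smul_mem _ _ (hdeg _ _))
        (Submodule.smul_mem _ _ (Submodule.sum_mem _ fun k _ =>
          Submodule.smul_mem _ _ (hdeg _ _))))
  · by_cases hj : j ∈ S
    · rw [if_pos hj, smul_add, add_sub_assoc (G := BMod F A)]
      refine Submodule.add_mem _ (Submodule.smul_mem _ _ (Submodule.smul_mem _ _ (hdeg _ _))) ?_
      split_ifs with hij
      · rw [sub_self (G := BMod F A)]
        exact Submodule.zero_mem _
      · rw [sub_zero (G := BMod F A)]
        refine Submodule.smul_mem _ _ ?_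
        by_cases hγ : γ j = 0
        · refine Submodule.mem_sup_left ((h.erase_of_ne hij hj hγ).zeroTensor_mem_sourceSub A ?_)
          rw [sum_add_single]
          omega
        · rw [zeroTensor_eq_zero hA j hγ (by simp)]
          exact Submodule.zero_mem _
    · have hij : j ≠ i := fun e => hj (e ▸ h.1.1)
      rw [if_neg hj, if_neg hij, sub_zero (G := BMod F A)]
      exact Submodule.zero_mem _

/-- The homotopy matching each target element with its source element. -/
def homotopyOp (F : Type) [Field F] (A : Matrix ι ι ℕ) : BMod F A →ₗ[F] BMod F A :=
  (Finsupp.basisSingleOne.tensorProduct (Pi.basisFun F (Finset ι))).constr F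
    fun p : {m : MonIdx ι // OKA A m} × Finset ι =>
      ∑ i, if IsTarget p.1.1.1 (fun k => ⌊lamRow A p.1.1.2 k⌋₊) p.2 i then
        extSign F i p.2 • zeroTensor F A p.1.1.1
          ((fun k => ⌊lamRow A p.1.1.2 k⌋₊) - Pi.single i 1) (insert i p.2) else 0

lemma homotopyOp_zeroTensor {A : Matrix ι ι ℕ} (hA : (Aq A).det ≠ 0) {γ μ : ι → ℕ}
    {S : Finset ι} (h : OKA A (γ, mulTransposeVec A μ)) :
    homotopyOp F A (zeroTensor F A γ μ S) =
      ∑ i, if IsTarget γ μ S i then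
        extSign F i S • zeroTensor F A γ (μ - Pi.single i 1) (insert i S) else 0 := by
  have hb : zeroTensor F A γ μ S =
      Finsupp.basisSingleOne.tensorProduct (Pi.basisFun F (Finset ι)) (⟨_, h⟩, S) := by
    rw [zeroTensor_of_OKA h, Module.Basis.tensorProduct_apply]
    simp [basisTensor]
  have hμ : (fun k => ⌊lamRow A (mulTransposeVec A μ) k⌋₊) = μ := by
    rw [lamRow_mulTransposeVec hA]
    simp
  rw [hb, homotopyOp, Module.Basis.constr_basis]
  simp only [hμ]

lemma homotopyOp_of_not_isTarget {A : Matrix ι ι ℕ} (hA : (Aq A).det ≠ 0) {γ μ : ι → ℕ}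
    {S : Finset ι} (h : ∀ i, ¬ IsTarget γ μ S i) :
    homotopyOp F A (zeroTensor F A γ μ S) = 0 := by
  by_cases hok : OKA A (γ, mulTransposeVec A μ)
  · rw [homotopyOp_zeroTensor hA hok]
    simp [h]
  · obtain ⟨i, hi, hi'⟩ := exists_of_not_OKA hA hok
    rw [zeroTensor_eq_zero hA i hi hi', map_zero]

lemma IsSource.homotopyOp_target {A : Matrix ι ι ℕ} (hA : (Aq A).det ≠ 0) {γ μ : ι → ℕ}
    {S : Finset ι} {i : ι} (h : IsSource γ μ S i) (hok : OKA A (γ, mulTransposeVec A μ)) :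
    homotopyOp F A (zeroTensor F A γ (μ + Pi.single i 1) (S.erase i)) =
      extSign F i S • zeroTensor F A γ μ S := by
  rw [homotopyOp_zeroTensor hA, Finset.sum_eq_single i, if_pos h.isTarget, extSign_erase h.1.1,
    if_neg (lt_irrefl i), add_tsub_cancel_right, Finset.insert_erase h.1.1]
  · intro j _ hji
    rw [if_neg]
    exact fun hj => hji (hj.unique h.isTarget)
  · simp
  · rw [OKA_mulTransposeVec_iff hA] at hok ⊢
    intro j
    by_cases hj : j = i
    · subst hj
      exact Or.inl h.1.2
    · simpa [hj] using hok j

lemma homotopyOp_degSub {A : Matrix ι ι ℕ} (hA : (Aq A).det ≠ 0) (m : ℕ) :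
    degSub F A (m + 1) ≤ (sourceSub F A m).comap (homotopyOp F A) := by
  refine Submodule.span_le.2 ?_
  rintro _ ⟨γ, μ, S, hm, rfl⟩
  change homotopyOp F A (zeroTensor F A γ μ S) ∈ sourceSub F A m
  by_cases hok : OKA A (γ, mulTransposeVec A μ)
  · by_cases ht : ∃ i, IsTarget γ μ S i
    · obtain ⟨i, hi⟩ := ht
      rw [OKA_mulTransposeVec_iff hA] at hok
      obtain ⟨ν, rfl, hν⟩ := hi.exists_isSource ((hok i).resolve_right hi.1.2)
      have hok' : OKA A (γ, mulTransposeVec A ν) := by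
        rw [OKA_mulTransposeVec_iff hA]
        intro j
        rcases hok j with h | h
        · exact Or.inl h
        · exact Or.inr (by simp at h; exact h.1)
      have := hν.homotopyOp_target (F := F) hA hok'
      rw [Finset.erase_insert hi.1.1] at this
      rw [this]
      rw [sum_add_single] at hm
      exact Submodule.smul_mem _ _ (hν.zeroTensor_mem_sourceSub A (by omega))
    · rw [homotopyOp_of_not_isTarget hA (not_exists.1 ht)]
      exact Submodule.zero_mem _
  · obtain ⟨i, hi, hi'⟩ := exists_of_not_OKA hA hok
    rw [zeroTensor_eq_zero hA i hi hi', map_zero]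
    exact Submodule.zero_mem _

lemma homotopyOp_sourceSub {A : Matrix ι ι ℕ} (hA : (Aq A).det ≠ 0) (m : ℕ) :
    sourceSub F A m ≤ LinearMap.ker (homotopyOp F A) := by
  refine Submodule.span_le.2 ?_
  rintro _ ⟨γ, μ, S, i, hs, hm, rfl⟩
  exact homotopyOp_of_not_isTarget hA fun j => hs.not_isTarget

lemma homotopyOp_DOp_sub_mem {A : Matrix ι ι ℕ} (hA : (Aq A).det ≠ 0) (π : F) (m : ℕ) :
    sourceSub F A (m + 1) ≤
      (sourceSub F A m).comap
        (homotopyOp F A ∘ₗ DOp F π A + (-1 : F) • (LinearMap.id : BMod F A →ₗ[F] BMod F A)) := by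
  refine Submodule.span_le.2 ?_
  rintro _ ⟨γ, μ, S, i, hs, hm, rfl⟩
  change homotopyOp F A (DOp F π A (zeroTensor F A γ μ S)) +
    (-1 : F) • zeroTensor F A γ μ S ∈ sourceSub F A m
  by_cases hok : OKA A (γ, mulTransposeVec A μ)
  · obtain ⟨u, hu, v, hv, huv⟩ := Submodule.mem_sup.1 (hs.DOp_sub_mem (F := F) hA π)
    rw [eq_sub_iff_add_eq] at huv
    rw [← huv, map_add, map_add, map_smul, hs.homotopyOp_target hA hok, smul_smul,
      extSign_mul_self, one_smul,
      LinearMap.mem_ker.1 (homotopyOp_sourceSub hA _ hu), zero_add, neg_one_smul F (M := BMod F A),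
      add_neg_cancel_right (G := BMod F A)]
    exact sourceSub_mono A (Nat.lt_succ_iff.1 hm) (homotopyOp_degSub hA _ hv)
  · obtain ⟨j, hj, hj'⟩ := exists_of_not_OKA hA hok
    rw [zeroTensor_eq_zero hA j hj hj', map_zero, map_zero, smul_zero, zero_add]
    exact Submodule.zero_mem _

lemma eq_zero_of_homotopyOp_DOp {A : Matrix ι ι ℕ} (hA : (Aq A).det ≠ 0) (π : F) (m : ℕ) :
    ∀ u ∈ sourceSub F A m, homotopyOp F A (DOp F π A u) = 0 → u = 0 := by
  induction m with
  | zero =>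
    intro u hu _
    have h : sourceSub F A 0 = ⊥ := by simp [sourceSub]
    rwa [h, Submodule.mem_bot] at hu
  | succ m ih =>
    intro u hu h
    refine ih u ?_ h
    have := homotopyOp_DOp_sub_mem hA π m hu
    change homotopyOp F A (DOp F π A u) + (-1 : F) • u ∈ sourceSub F A m at this
    rw [h, zero_add] at this
    exact (Submodule.smul_mem_iff _ (neg_ne_zero.2 one_ne_zero)).1 this

/-- The linear map `x^γ ↦ x^{γ + S} y^0`. -/
def shiftMon (F : Type) [Field F] (A : Matrix ι ι ℕ) (S : Finset ι) :
    MvPolynomial ι F →ₗ[F] RMod F A :=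
  (MvPolynomial.basisMonomials ι F).constr F fun d =>
    bE F A ((fun j => d j + (if j ∈ S then 1 else 0)), 0)

lemma shiftMon_monomial (A : Matrix ι ι ℕ) (S : Finset ι) (d : ι →₀ ℕ) (a : F) :
    shiftMon F A S (MvPolynomial.monomial d a) =
      a • zeroMon F A (fun j => d j + if j ∈ S then 1 else 0) 0 := by
  have h : MvPolynomial.monomial d a = a • MvPolynomial.basisMonomials ι F d := by
    simp [MvPolynomial.smul_monomial]
  have h0 : mulTransposeVec A 0 = 0 := by
    funext j
    simp [mulTransposeVec]
  rw [h, map_smul, shiftMon, Module.Basis.constr_basis, zeroMon, h0]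

lemma projS_single (S T : Finset ι) :
    projS F T (Pi.single S 1) = if S = T then Pi.single T 1 else 0 := by
  rw [projS, ← Pi.basisFun_apply F (Finset ι) S, Module.Basis.constr_basis]

lemma ThetaMap_tmul_single (A : Matrix ι ι ℕ) (p : MvPolynomial ι F) (S : Finset ι) :
    ThetaMap F A (p ⊗ₜ Pi.single S 1) = shiftMon F A S p ⊗ₜ Pi.single S 1 := by
  rw [ThetaMap, LinearMap.sum_apply, Finset.sum_eq_single S]
  · rw [TensorProduct.map_tmul, projS_single, if_pos rfl, shiftMon]
  · intro T _ hT
    rw [TensorProduct.map_tmul, projS_single, if_neg hT.symm, TensorProduct.tmul_zero]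
  · simp

lemma ThetaMap_monomial_tmul (A : Matrix ι ι ℕ) (d : ι →₀ ℕ) (S : Finset ι) :
    ThetaMap F A (MvPolynomial.monomial d 1 ⊗ₜ Pi.single S 1) =
      zeroTensor F A (fun j => d j + if j ∈ S then 1 else 0) 0 S := by
  rw [ThetaMap_tmul_single, shiftMon_monomial, one_smul, zeroTensor]

lemma zeroTensor_trichotomy {A : Matrix ι ι ℕ} (hA : (Aq A).det ≠ 0) {γ μ : ι → ℕ}
    {S : Finset ι} (hok : OKA A (γ, mulTransposeVec A μ)) :
    zeroTensor F A γ μ S ∈ LinearMap.range (ThetaMap F A) ∨ (∃ i, IsSource γ μ S i) ∨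
      ∃ i, IsTarget γ μ S i := by
  by_cases h : ∃ i, IsObstruction γ μ S i
  · obtain ⟨i, hi, hmin⟩ := WellFounded.has_min (wellFounded_lt (α := ι))
      {i | IsObstruction γ μ S i} h
    have hmin' : ∀ j < i, ¬ IsObstruction γ μ S j := fun j hj hb => hmin j hb hj
    rcases hi with hi | hi
    · exact Or.inr (Or.inr ⟨i, hi, hmin'⟩)
    · exact Or.inr (Or.inl ⟨i, hi, hmin'⟩)
  · left
    push Not at h
    rw [OKA_mulTransposeVec_iff hA] at hok
    have hS : ∀ i ∈ S, γ i ≠ 0 := fun i hi h0 => h i (Or.inr ⟨hi, h0⟩)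
    have hμ : μ = 0 := by
      funext i
      by_contra h0
      by_cases hi : i ∈ S
      · exact (hok i).elim (hS i hi) h0
      · exact h i (Or.inl ⟨hi, h0⟩)
    refine ⟨MvPolynomial.monomial
      (Finsupp.equivFunOnFinite.symm fun j => γ j - if j ∈ S then 1 else 0) 1 ⊗ₜ Pi.single S 1, ?_⟩
    rw [ThetaMap_monomial_tmul, hμ]
    congr 1
    funext j
    simp only [Finsupp.equivFunOnFinite_symm_apply_apply]
    split_ifs with hj
    · have := hS j hj
      omega
    · rfl

lemma degSub_le {A : Matrix ι ι ℕ} (hA : (Aq A).det ≠ 0) (π : F) (m : ℕ) :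
    degSub F A m ≤ ((sourceSub F A m).map (DOp F π A) ⊔ LinearMap.range (ThetaMap F A)) ⊔
      sourceSub F A m := by
  induction m with
  | zero => simp [degSub]
  | succ m ih =>
    have ih' := ih.trans (sup_le_sup (sup_le_sup_right
      (Submodule.map_mono (f := DOp F π A) (sourceSub_mono A m.le_succ)) _)
      (sourceSub_mono A m.le_succ))
    refine Submodule.span_le.2 ?_
    rintro _ ⟨γ, μ, S, hm, rfl⟩
    by_cases hok : OKA A (γ, mulTransposeVec A μ)
    · rcases zeroTensor_trichotomy (F := F) (S := S) hA hok with h | ⟨i, h⟩ | ⟨i, h⟩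
      · exact Submodule.mem_sup_left (Submodule.mem_sup_right h)
      · exact Submodule.mem_sup_right (h.zeroTensor_mem_sourceSub A hm)
      · rw [OKA_mulTransposeVec_iff hA] at hok
        obtain ⟨ν, rfl, hν⟩ := h.exists_isSource ((hok i).resolve_right h.1.2)
        rw [sum_add_single] at hm
        have hD := hν.DOp_sub_mem hA π
        rw [Finset.erase_insert h.1.1] at hD
        have hD' := sup_le ((sourceSub_mono A (by omega)).trans le_sup_right)
          ((degSub_mono A (by omega)).trans ih') hD
        have hu := Submodule.mem_sup_left (T := sourceSub F A (m + 1))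
          (Submodule.mem_sup_left (T := LinearMap.range (ThetaMap F A))
          (Submodule.mem_map_of_mem (f := DOp F π A)
            (hν.zeroTensor_mem_sourceSub (F := F) A (m := m + 1) (by omega))))
        have := Submodule.smul_mem _ (extSign F i (insert i S))
          (Submodule.sub_mem (M := BMod F A) _ hu hD')
        rwa [sub_sub_cancel, smul_smul, extSign_mul_self, one_smul] at this
    · obtain ⟨j, hj, hj'⟩ := exists_of_not_OKA hA hok
      rw [zeroTensor_eq_zero hA j hj hj']
      exact Submodule.zero_mem _
lemma zeroTensor_mem_B0Sub {A : Matrix ι ι ℕ} (hA : (Aq A).det ≠ 0) (γ μ : ι → ℕ)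
    (S : Finset ι) : zeroTensor F A γ μ S ∈ B0Sub F A := by
  by_cases hok : OKA A (γ, mulTransposeVec A μ)
  · rw [zeroTensor_of_OKA hok]
    exact Submodule.subset_span ⟨_, S, ⟨μ, fun j => by simp [mulTransposeVec]⟩, rfl⟩
  · obtain ⟨i, hi, hi'⟩ := exists_of_not_OKA hA hok
    rw [zeroTensor_eq_zero hA i hi hi']
    exact Submodule.zero_mem _

lemma degSub_le_B0Sub {A : Matrix ι ι ℕ} (hA : (Aq A).det ≠ 0) (m : ℕ) :
    degSub F A m ≤ B0Sub F A := by
  refine Submodule.span_le.2 ?_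
  rintro _ ⟨γ, μ, S, hm, rfl⟩
  exact zeroTensor_mem_B0Sub hA γ μ S

lemma exists_mem_degSub {A : Matrix ι ι ℕ} {x : BMod F A} (hx : x ∈ B0Sub F A) :
    ∃ m, x ∈ degSub F A m := by
  refine Submodule.span_induction ?_ ?_ ?_ ?_ hx
  · rintro _ ⟨⟨⟨γ, lam⟩, hm⟩, S, ⟨μ, hμ⟩, rfl⟩
    obtain rfl : lam = mulTransposeVec A μ := by
      funext j
      simpa [mulTransposeVec] using hμ j
    refine ⟨∑ i, μ i + 1, ?_⟩
    rw [← zeroTensor_of_OKA hm]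
    exact zeroTensor_mem_degSub A _ _ _ (Nat.lt_succ_self _)
  · exact ⟨0, Submodule.zero_mem _⟩
  · rintro x y _ _ ⟨m, hm⟩ ⟨k, hk⟩
    exact ⟨max m k, Submodule.add_mem _ (degSub_mono A (le_max_left _ _) hm)
      (degSub_mono A (le_max_right _ _) hk)⟩
  · rintro a x _ ⟨m, hm⟩
    exact ⟨m, Submodule.smul_mem _ _ hm⟩

lemma DOp_DOp_of_mem_degSub {A : Matrix ι ι ℕ} (hA : (Aq A).det ≠ 0) (π : F) {m : ℕ}
    {x : BMod F A} (hx : x ∈ degSub F A m) : DOp F π A (DOp F π A x) = 0 := by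
  have h : degSub F A m ≤ LinearMap.ker (DOp F π A ∘ₗ DOp F π A) := by
    refine Submodule.span_le.2 ?_
    rintro _ ⟨γ, μ, S, hm, rfl⟩
    exact DOp_DOp_zeroTensor hA π γ μ S
  exact h hx

lemma DOp_mem_B0Sub {A : Matrix ι ι ℕ} (hA : (Aq A).det ≠ 0) (π : F) {x : BMod F A}
    (hx : x ∈ B0Sub F A) : DOp F π A x ∈ B0Sub F A := by
  obtain ⟨m, hm⟩ := exists_mem_degSub hx
  have h : degSub F A m ≤ (B0Sub F A).comap (DOp F π A) := by
    refine Submodule.span_le.2 ?_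
    rintro _ ⟨γ, μ, S, hm, rfl⟩
    change DOp F π A (zeroTensor F A γ μ S) ∈ B0Sub F A
    have ht := zeroTensor_mem_B0Sub (F := F) hA
    rw [DOp_zeroTensor hA]
    refine Submodule.add_mem _ (Submodule.sum_mem _ fun j _ => ?_)
      (Submodule.sum_mem _ fun j _ => ?_)
    · split_ifs
      · exact Submodule.zero_mem _
      · exact Submodule.smul_mem _ _ (Submodule.add_mem _ (Submodule.smul_mem _ _ (ht _ _ _))
          (Submodule.smul_mem _ _ (Submodule.sum_mem _ fun k _ =>
            Submodule.smul_mem _ _ (ht _ _ _))))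
    · split_ifs
      · exact Submodule.smul_mem _ _ (Submodule.add_mem _ (Submodule.smul_mem _ _ (ht _ _ _))
          (ht _ _ _))
      · exact Submodule.zero_mem _
  exact h hm

lemma DRMod_induction {p : DRMod F ι → Prop} (x : DRMod F ι)
    (single : ∀ (d : ι →₀ ℕ) (S : Finset ι),
      p (MvPolynomial.monomial d 1 ⊗ₜ[F] Pi.single S 1))
    (zero : p 0) (add : ∀ x y, p x → p y → p (x + y)) (smul : ∀ (a : F) x, p x → p (a • x)) :
    p x := by
  refine Submodule.span_induction (p := fun x _ => p x) ?_ zero (fun x y _ _ => add x y)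
    (fun a x _ => smul a x)
    (((MvPolynomial.basisMonomials ι F).tensorProduct (Pi.basisFun F (Finset ι))).mem_span x)
  rintro _ ⟨⟨d, S⟩, rfl⟩
  rw [Module.Basis.tensorProduct_apply]
  simpa using single d S

lemma ThetaMap_mem_B0Sub {A : Matrix ι ι ℕ} (hA : (Aq A).det ≠ 0) (x : DRMod F ι) :
    ThetaMap F A x ∈ B0Sub F A := by
  induction x using DRMod_induction with
  | single d S =>
    rw [ThetaMap_monomial_tmul]
    exact zeroTensor_mem_B0Sub hA _ _ _
  | zero =>
    rw [map_zero]
    exact Submodule.zero_mem _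
  | add x y hx hy =>
    rw [map_add]
    exact Submodule.add_mem _ hx hy
  | smul a x hx =>
    rw [map_smul]
    exact Submodule.smul_mem _ _ hx

lemma homotopyOp_ThetaMap {A : Matrix ι ι ℕ} (hA : (Aq A).det ≠ 0) (x : DRMod F ι) :
    homotopyOp F A (ThetaMap F A x) = 0 := by
  induction x using DRMod_induction with
  | single d S =>
    rw [ThetaMap_monomial_tmul]
    exact homotopyOp_of_not_isTarget hA fun i h => h.1.2 rfl
  | zero => rw [map_zero, map_zero]
  | add x y hx hy => rw [map_add, map_add, hx, hy, add_zero]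
  | smul a x hx => rw [map_smul, map_smul, hx, smul_zero]

lemma ThetaMap_injective {A : Matrix ι ι ℕ} (hA : (Aq A).det ≠ 0) :
    Function.Injective (ThetaMap F A) := by
  let G : BMod F A →ₗ[F] DRMod F ι :=
    (Finsupp.basisSingleOne.tensorProduct (Pi.basisFun F (Finset ι))).constr F
      fun p : {m : MonIdx ι // OKA A m} × Finset ι =>
        MvPolynomial.monomial
          (Finsupp.equivFunOnFinite.symm fun j => p.1.1.1 j - if j ∈ p.2 then 1 else 0) 1 ⊗ₜ
            Pi.single p.2 1
  refine Function.LeftInverse.injective (g := G) fun x => ?_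
  induction x using DRMod_induction with
  | single d S =>
    have hok : OKA A ((fun j => d j + if j ∈ S then 1 else 0), mulTransposeVec A 0) :=
      (OKA_mulTransposeVec_iff hA _ _).2 fun i => Or.inr rfl
    have hb : zeroTensor F A (fun j => d j + if j ∈ S then 1 else 0) 0 S =
        Finsupp.basisSingleOne.tensorProduct (Pi.basisFun F (Finset ι)) (⟨_, hok⟩, S) := by
      rw [zeroTensor_of_OKA hok, Module.Basis.tensorProduct_apply]
      simp [basisTensor]
    rw [ThetaMap_monomial_tmul, hb, Module.Basis.constr_basis]
    have hd : (Finsupp.equivFunOnFinite.symm fun j => d j) = d := Finsupp.ext fun _ => rfl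
    simp only [add_tsub_cancel_right, hd]
  | zero => rw [map_zero, map_zero]
  | add x y hx hy => rw [map_add, map_add, hx, hy]
  | smul a x hx => rw [map_smul, map_smul, hx]

lemma shiftMon_insert_pderiv_monomial (A : Matrix ι ι ℕ) {i : ι} {S : Finset ι} (hi : i ∉ S)
    (d e : ι →₀ ℕ) :
    shiftMon F A (insert i S)
        (MvPolynomial.pderiv i (MvPolynomial.monomial e 1) * MvPolynomial.monomial d 1) =
      (e i : F) • zeroMon F A (fun k => (d k + if k ∈ S then 1 else 0) + e k) 0 := by
  rw [MvPolynomial.pderiv_monomial, MvPolynomial.monomial_mul, shiftMon_monomial, one_mul, mul_one]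
  by_cases he : e i = 0
  · rw [he, Nat.cast_zero, zero_smul, zero_smul]
  congr 2
  funext k
  by_cases hk : k = i
  · subst hk
    simp [hi]
    omega
  · simp [hk]
    omega

lemma ThetaMap_dDR_monomial (A : Matrix ι ι ℕ) (π : F) (d : ι →₀ ℕ) (S : Finset ι) :
    ThetaMap F A (dDR F π A (MvPolynomial.monomial d 1 ⊗ₜ Pi.single S 1)) =
      ∑ i, if i ∈ S then 0 else extSign F i S •
        ((d i : F) • zeroTensor F A (fun j => d j + if j ∈ S then 1 else 0) 0 (insert i S) +
          π • ∑ j, (A j i : F) • zeroTensor F A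
            (fun k => (d k + if k ∈ S then 1 else 0) + A j k) 0 (insert i S)) := by
  rw [dDR, LinearMap.sum_apply, map_sum]
  refine Finset.sum_congr rfl fun i _ => ?_
  rw [TensorProduct.map_tmul, mulE_single]
  split_ifs with hi
  · rw [TensorProduct.tmul_zero, map_zero]
  have h1 := shiftMon_insert_pderiv_monomial (F := F) A hi 0 d
  simp only [MvPolynomial.monomial_zero', map_one, mul_one, Finsupp.coe_zero, Pi.zero_apply,
    zero_add, add_comm _ (d _)] at h1
  have h2 : shiftMon F A (insert i S)
      (MvPolynomial.pderiv i (Wpoly F A) * MvPolynomial.monomial d 1) =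
      ∑ j, (A j i : F) • zeroMon F A (fun k => (d k + if k ∈ S then 1 else 0) + A j k) 0 := by
    rw [Wpoly_eq_sum_monomial, map_sum, Finset.sum_mul, map_sum]
    exact Finset.sum_congr rfl fun j _ => shiftMon_insert_pderiv_monomial A hi d _
  rw [TensorProduct.tmul_smul, map_smul, ThetaMap_tmul_single, LinearMap.add_apply,
    LinearMap.smul_apply, LinearMap.mulLeft_apply, map_add, map_smul, h2,
    Derivation.coeFn_coe, h1]
  simp only [zeroTensor, TensorProduct.add_tmul, ← TensorProduct.smul_tmul',
    TensorProduct.sum_tmul]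

lemma ThetaMap_dDR {A : Matrix ι ι ℕ} (hA : (Aq A).det ≠ 0) (π : F) (x : DRMod F ι) :
    ThetaMap F A (dDR F π A x) = DOp F π A (ThetaMap F A x) := by
  induction x using DRMod_induction with
  | single d S =>
    rw [ThetaMap_dDR_monomial, ThetaMap_monomial_tmul, DOp_zeroTensor hA]
    refine (add_zero (M := BMod F A) _).symm.trans
      (congrArg₂ (· + ·) (Finset.sum_congr rfl fun i _ => ?_)
        (Finset.sum_eq_zero fun i _ => ?_).symm)
    · by_cases hi : i ∈ S
      · rw [if_pos hi, if_pos hi]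
      · simp only [if_neg hi, add_zero]
    · by_cases hi : i ∈ S
      · rw [if_pos hi, zeroTensor_eq_zero (μ := 0 + Pi.single i 1) hA i (by simp [hi]) (by simp)]
        simp
      · rw [if_neg hi]
  | zero => simp only [map_zero]
  | add x y hx hy => simp only [map_add, hx, hy]
  | smul a x hx => simp only [map_smul, hx]

lemma exists_decomposition {A : Matrix ι ι ℕ} (hA : (Aq A).det ≠ 0) (π : F) {b : BMod F A}
    (hb : b ∈ B0Sub F A) :
    ∃ m, ∃ u ∈ sourceSub F A m, ∃ c, ∃ v ∈ sourceSub F A m,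
      b = DOp F π A u + ThetaMap F A c + v := by
  obtain ⟨m, hm⟩ := exists_mem_degSub hb
  obtain ⟨w, hw, v, hv, rfl⟩ := Submodule.mem_sup.1 (degSub_le hA π m hm)
  obtain ⟨_, ⟨u, hu, rfl⟩, _, ⟨c, rfl⟩, rfl⟩ := Submodule.mem_sup.1 hw
  exact ⟨m, u, hu, c, v, hv, rfl⟩

lemma exists_eq_add_of_DOp_eq_ThetaMap {A : Matrix ι ι ℕ} (hA : (Aq A).det ≠ 0) (π : F)
    {b : BMod F A} (hb : b ∈ B0Sub F A) {c : DRMod F ι} (h : DOp F π A b = ThetaMap F A c) :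
    ∃ c', c = dDR F π A c' ∧ ∃ b' ∈ B0Sub F A, b = ThetaMap F A c' + DOp F π A b' := by
  obtain ⟨m, u, hu, c', v, hv, rfl⟩ := exists_decomposition hA π hb
  rw [map_add, map_add, DOp_DOp_of_mem_degSub hA π (sourceSub_le_degSub A m hu), zero_add,
    ← ThetaMap_dDR hA] at h
  have hv0 : v = 0 := by
    refine eq_zero_of_homotopyOp_DOp hA π m v hv ?_
    have := congrArg (homotopyOp F A) h
    rwa [map_add, homotopyOp_ThetaMap hA, homotopyOp_ThetaMap hA, zero_add] at this
  rw [hv0, map_zero, add_zero] at h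
  refine ⟨c', (ThetaMap_injective hA h).symm, u,
    degSub_le_B0Sub hA m (sourceSub_le_degSub A m hu), ?_⟩
  rw [hv0, add_zero, add_comm]

end Complexes

end

/-- Proposition 6.2: the map `Θ(x^γ ⊗ e_I) = x^{γ+I} ⊗ e_I` is an injective chain map
from the de Rham complex `DR_A(F)` to `B^0_A(F)`, and it is a quasi-isomorphism
(it induces isomorphisms on all cohomology groups, expressed here elementwise). -/
theorem deRham_to_B0_quasiIso (F : Type) [Field F] (n : ℕ)
    (A : Matrix (Fin n) (Fin n) ℕ) (hA : IsBH F A) (π : F) (hπ : π ≠ 0) :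
    (∀ x : DRMod F (Fin n), ThetaMap F A x ∈ B0Sub F A) ∧
    Function.Injective (ThetaMap F A) ∧
    (ThetaMap F A).comp (dDR F π A) = (DOp F π A).comp (ThetaMap F A) ∧
    (∀ x ∈ B0Sub F A, DOp F π A x ∈ B0Sub F A) ∧
    (∀ b ∈ B0Sub F A, b ∈ LinearMap.ker (DOp F π A) →
      ∃ c ∈ LinearMap.ker (dDR F π A),
        ∃ b' ∈ B0Sub F A, b = ThetaMap F A c + DOp F π A b') ∧
    (∀ c ∈ LinearMap.ker (dDR F π A),
      (∃ b' ∈ B0Sub F A, ThetaMap F A c = DOp F π A b') →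
      ∃ c' : DRMod F (Fin n), c = dDR F π A c') := by
  have hA' : (Aq A).det ≠ 0 := hA.1
  refine ⟨ThetaMap_mem_B0Sub hA', ThetaMap_injective hA', LinearMap.ext (ThetaMap_dDR hA' π),
    fun x => DOp_mem_B0Sub hA' π, fun b hb hker => ?_, ?_⟩
  · obtain ⟨c, hc, h⟩ := exists_eq_add_of_DOp_eq_ThetaMap (c := 0) hA' π hb
      (by rw [map_zero]; exact hker)
    exact ⟨c, hc.symm, h⟩
  · rintro c - ⟨b, hb, h⟩
    obtain ⟨c', hc', -⟩ := exists_eq_add_of_DOp_eq_ThetaMap hA' π hb h.symm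
    exact ⟨c', hc'⟩
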